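/- There is no metric d on the five points {1,2,3,4,5} (d symmetric, vanishing exactly on the diagonal, satisfying the triangle inequality) such that every quadruple of indices a < b < c < d satisfies R₃ > R₁ > R₂, where R₁ = d(a,b) + d(c,d), R₂ = d(a,c) + d(b,d), R₃ = d(a,d) + d(b,c). That is, there is no monochromatic metric space on 5 ordered points of colour 312. -/

import Mathlib

/-- A metric on `Fin n`, given as an explicit distance function. -/
def IsMetric {n : ℕ} (d : Fin n → Fin n → ℝ) : Prop :=
  (∀ i, d i i = 0) ∧ (∀ i j, d i j = d j i) ∧ (∀ i j, i ≠ j → 0 < d i j) ∧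
  (∀ i j k, d i k ≤ d i j + d j k)

/-- There is no metric on five ordered points which is monochromatic of colour 312,
i.e. in which every quadruple `a < b < c < e` satisfies `R₃ > R₁ > R₂`, where
`R₁ = d a b + d c e`, `R₂ = d a c + d b e`, `R₃ = d a e + d b c`. -/
theorem no_monochromatic_312 :
    ¬ ∃ d : Fin 5 → Fin 5 → ℝ, IsMetric d ∧
      ∀ a b c e : Fin 5, a < b → b < c → c < e →
        d a e + d b c > d a b + d c e ∧ d a b + d c e > d a c + d b e := by
  rintro ⟨d, _, h⟩
  have h1 := h 0 1 2 3 (by decide) (by decide) (by decide)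
  have h2 := h 0 1 2 4 (by decide) (by decide) (by decide)
  have h3 := h 0 1 3 4 (by decide) (by decide) (by decide)
  have h4 := h 0 2 3 4 (by decide) (by decide) (by decide)
  have h5 := h 1 2 3 4 (by decide) (by decide) (by decide)
  linarith [h1.1, h1.2, h2.1, h2.2, h3.1, h3.2, h4.1, h4.2, h5.1, h5.2]
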